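/- arXiv:2207.08791 — 2 statements merged into one kernel-verified Lean document; each statement's English description precedes it below -/
import Mathlib

section
/- Let E : ℕ → ℝ be a nondecreasing sequence with E 0 = 0 and E i ≥ 0 satisfying the Gibbs condition, and let F_E be the associated maximal-entropy function. Let n ≥ 1, let P₀ be a convex set of probability distributions on ℕⁿ with the Δ-property, and let f : P₀ → ℝ belong to the class T_n^1(C,D) on P₀. Then for every t > 0, every ε ∈ (0,1], and all p, q ∈ P₀ whose first marginals satisfy ∑_i (E i)·(p₁ i) ≤ t and ∑_i (E i)·(q₁ i) ≤ t, and such that TV(p,q) ≤ ε, one has |f(p) − f(q)| ≤ C·ε·F_E(t/ε) + D·g(ε). -/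
open scoped ENNReal
/-- `p` is a probability distribution on `α`: nonnegative entries summing to `1`. -/
def IsProbDist {α : Type*} (p : α → ℝ) : Prop := (∀ x, 0 ≤ p x) ∧ HasSum p 1

/-- Extended-real-valued Shannon entropy `H(r) = ∑ η(r i) ∈ [0,+∞]`,
where `η(x) = −x ln x`. -/
noncomputable def shEnt (r : ℕ → ℝ) : ℝ≥0∞ :=
  ∑' i, ENNReal.ofReal (Real.negMulLog (r i))

/-- Total variation distance `TV(p,q) = (1/2)·∑ |p x − q x|`. -/
noncomputable def TVd {α : Type*} (p q : α → ℝ) : ℝ := (1 / 2) * ∑' x, |p x - q x|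

/-- `g(x) = (x+1)·ln(x+1) − x·ln x` (with `g(0) = 0`, as `Real.log 0 = 0`). -/
noncomputable def gFun (x : ℝ) : ℝ := (x + 1) * Real.log (x + 1) - x * Real.log x

/-- Binary entropy `h₂(x) = η(x) + η(1−x)`. -/
noncomputable def h2 (x : ℝ) : ℝ := Real.negMulLog x + Real.negMulLog (1 - x)

/-- The `k`-th marginal of a distribution on `ℕⁿ`. -/
noncomputable def margN {n : ℕ} (p : (Fin n → ℕ) → ℝ) (k : Fin n) (j : ℕ) : ℝ :=
  ∑' x : Fin n → ℕ, if x k = j then p x else 0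

/-- `P₀` is convex (as a set of functions). -/
def ConvexDist {α : Type*} (P₀ : Set (α → ℝ)) : Prop :=
  ∀ p ∈ P₀, ∀ q ∈ P₀, ∀ lam : ℝ, 0 ≤ lam → lam ≤ 1 →
    (fun x => lam * p x + (1 - lam) * q x) ∈ P₀

/-- The Δ-property: for distinct `p, q ∈ P₀` the normalized positive and negative
parts of `p − q` belong to `P₀`. -/
def DeltaProp {α : Type*} (P₀ : Set (α → ℝ)) : Prop :=
  ∀ p ∈ P₀, ∀ q ∈ P₀, p ≠ q →
    (fun x => max (p x - q x) 0 / TVd p q) ∈ P₀ ∧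
    (fun x => max (q x - p x) 0 / TVd p q) ∈ P₀

/-- The sum `∑_{k=1}^m H(p_k)` of the entropies of the first `m` marginals. -/
noncomputable def margEntSum {n : ℕ} (m : ℕ) (p : (Fin n → ℕ) → ℝ) : ℝ≥0∞ :=
  ∑ k ∈ Finset.univ.filter (fun k : Fin n => (k : ℕ) < m), shEnt (margN p k)

/-- Membership in the class `T_n^m(C,D)` on `P₀`. -/
def InClassT {n : ℕ} (m : ℕ) (C D : ℝ) (P₀ : Set ((Fin n → ℕ) → ℝ))
    (f : ((Fin n → ℕ) → ℝ) → ℝ) : Prop :=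
  ∃ cm cp dm dp : ℝ, 0 ≤ cm ∧ 0 ≤ cp ∧ 0 ≤ dm ∧ 0 ≤ dp ∧
    cm + cp = C ∧ dm + dp = D ∧
    (∀ p ∈ P₀, ∀ q ∈ P₀, ∀ lam : ℝ, 0 ≤ lam → lam ≤ 1 →
      lam * f p + (1 - lam) * f q - dm * h2 lam ≤
        f (fun x => lam * p x + (1 - lam) * q x) ∧
      f (fun x => lam * p x + (1 - lam) * q x) ≤
        lam * f p + (1 - lam) * f q + dp * h2 lam) ∧
    (∀ p ∈ P₀, margEntSum m p ≠ ⊤ →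
      -(cm * (margEntSum m p).toReal) ≤ f p ∧ f p ≤ cp * (margEntSum m p).toReal)


/-- The Gibbs condition: `∑_i exp(−β·E i) < ∞` for every `β > 0`. -/
def GibbsCond (E : ℕ → ℝ) : Prop :=
  ∀ β : ℝ, 0 < β → Summable fun i => Real.exp (-β * E i)

/-- The mean energy `∑_i E i · p i ∈ [0,+∞]` (the terms being nonnegative for
probability distributions and nonnegative `E`). -/
noncomputable def meanE (E : ℕ → ℝ) (p : ℕ → ℝ) : ℝ≥0∞ :=
  ∑' i, ENNReal.ofReal (E i * p i)

/-- The maximal-entropy function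
`F_E(t) = sup{ H(p) : p prob. distribution on ℕ, ∑ E i · p i ≤ t }`. -/
noncomputable def FE (E : ℕ → ℝ) (t : ℝ) : ℝ :=
  sSup {h : ℝ | ∃ p : ℕ → ℝ, IsProbDist p ∧ meanE E p ≤ ENNReal.ofReal t ∧
    h = (shEnt p).toReal}

lemma TVd_comm {α : Type*} (p q : α → ℝ) : TVd p q = TVd q p := by
  simp only [TVd, abs_sub_comm]

lemma TVd_pos {α : Type*} {p q : α → ℝ} (hp : IsProbDist p) (hq : IsProbDist q)
    (hpq : p ≠ q) : 0 < TVd p q := by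
  obtain ⟨x, hx⟩ := Function.ne_iff.mp hpq
  have hs : Summable fun x => |p x - q x| := (hp.2.summable.sub hq.2.summable).abs
  have := hs.tsum_pos (fun _ => abs_nonneg _) x (abs_pos.mpr (sub_ne_zero.mpr hx))
  unfold TVd
  positivity

lemma gFun_monotoneOn : MonotoneOn gFun (Set.Ici 0) := by
  apply monotoneOn_of_deriv_nonneg (convex_Ici 0)
  · have h : Continuous gFun :=
      (Real.continuous_mul_log.comp (continuous_id.add continuous_const)).sub
        Real.continuous_mul_log
    exact h.continuousOn
  all_goals
    intro x hx
    rw [interior_Ici, Set.mem_Ioi] at hx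
    have h : HasDerivAt gFun (Real.log (x + 1) - Real.log x) x := by
      have h1 := (Real.hasDerivAt_mul_log hx.ne')
      have h2 := (Real.hasDerivAt_mul_log (by positivity : x + 1 ≠ 0)).comp_add_const x 1
      exact (h2.sub h1).congr_deriv (by ring)
  · exact h.differentiableAt.differentiableWithinAt
  · rw [h.deriv, sub_nonneg]
    exact Real.log_le_log hx (by linarith)

lemma gFun_nonneg {x : ℝ} (hx : 0 ≤ x) : 0 ≤ gFun x := by
  simpa [gFun] using gFun_monotoneOn Set.self_mem_Ici hx hx

/-- `(1 + δ) h₂(1 / (1 + δ)) = g(δ)`. -/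
lemma one_add_mul_h2_inv {δ : ℝ} (hδ : 0 < δ) : (1 + δ) * h2 (1 / (1 + δ)) = gFun δ := by
  have h1 : 1 - 1 / (1 + δ) = δ / (1 + δ) := by field_simp; ring
  rw [h2, h1, gFun, Real.negMulLog, Real.negMulLog, Real.log_div one_ne_zero (by positivity),
    Real.log_div hδ.ne' (by positivity), Real.log_one, add_comm δ 1]
  field_simp
  ring

lemma summable_fiber {n : ℕ} {p : (Fin n → ℕ) → ℝ} (hp : IsProbDist p) (k : Fin n) (j : ℕ) :
    Summable fun x : Fin n → ℕ => if x k = j then p x else 0 := by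
  refine hp.2.summable.of_nonneg_of_le (fun x => ?_) (fun x => ?_)
  all_goals have := hp.1 x; split_ifs <;> linarith

lemma isProbDist_margN {n : ℕ} {p : (Fin n → ℕ) → ℝ} (hp : IsProbDist p) (k : Fin n) :
    IsProbDist (margN p k) := by
  refine ⟨fun j => tsum_nonneg fun x => ?_, ?_⟩
  · have := hp.1 x
    split_ifs <;> linarith
  · refine HasSum.sigma ((Equiv.sigmaFiberEquiv fun x : Fin n → ℕ => x k).hasSum_iff.mpr hp.2)
      fun j => ?_
    have h := (summable_fiber hp k j).hasSum
    have he : (fun x : Fin n → ℕ => if x k = j then p x else 0) =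
        Set.indicator {x | x k = j} p := by
      ext x
      simp [Set.indicator_apply]
    change HasSum _ (∑' x : Fin n → ℕ, if x k = j then p x else 0)
    rw [he] at h ⊢
    exact hasSum_subtype_iff_indicator.mpr h

/-- If `δ r ≤ p` pointwise, the mean energy of a marginal of `r` is at most `1 / δ` times that
of `p`. -/
lemma meanE_margN_le_div {n : ℕ} {E : ℕ → ℝ} (hE : ∀ i, 0 ≤ E i) {p r : (Fin n → ℕ) → ℝ}
    (hp : IsProbDist p) (hr : IsProbDist r) {δ t : ℝ} (hδ : 0 < δ) (h : ∀ x, δ * r x ≤ p x)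
    (k : Fin n) (hpt : meanE E (margN p k) ≤ ENNReal.ofReal t) :
    meanE E (margN r k) ≤ ENNReal.ofReal (t / δ) := by
  have hle : ∀ j, δ * margN r k j ≤ margN p k j := fun j => by
    rw [margN, ← tsum_mul_left]
    refine ((summable_fiber hr k j).mul_left δ).tsum_le_tsum (fun x => ?_) (summable_fiber hp k j)
    split_ifs
    exacts [h x, by simp]
  calc meanE E (margN r k)
      ≤ ∑' j, ENNReal.ofReal δ⁻¹ * ENNReal.ofReal (E j * margN p k j) := by
        refine ENNReal.tsum_le_tsum fun j => ?_
        rw [← ENNReal.ofReal_mul (by positivity)]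
        refine ENNReal.ofReal_le_ofReal ?_
        rw [← div_eq_inv_mul, le_div_iff₀ hδ]
        have := mul_le_mul_of_nonneg_left (hle j) (hE j)
        linarith
    _ = ENNReal.ofReal δ⁻¹ * meanE E (margN p k) := ENNReal.tsum_mul_left
    _ ≤ ENNReal.ofReal δ⁻¹ * ENNReal.ofReal t := by gcongr
    _ = ENNReal.ofReal (t / δ) := by
        rw [← ENNReal.ofReal_mul (by positivity), div_eq_inv_mul]

/-- The pointwise Gibbs inequality. -/
lemma negMulLog_le_mul_add_exp {x : ℝ} (hx : 0 ≤ x) (e : ℝ) :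
    Real.negMulLog x ≤ e * x + Real.exp (-e) := by
  rcases hx.eq_or_lt with rfl | hx
  · simp [(Real.exp_pos _).le]
  · have h := Real.log_le_sub_one_of_pos (div_pos (Real.exp_pos (-e)) hx)
    rw [Real.log_div (Real.exp_pos _).ne' hx.ne', Real.log_exp] at h
    have h' := mul_le_mul_of_nonneg_left h hx.le
    have : x * (Real.exp (-e) / x - 1) = Real.exp (-e) - x := by field_simp
    rw [this] at h'
    rw [Real.negMulLog]
    linarith

lemma shEnt_le {E : ℕ → ℝ} (hE : ∀ i, 0 ≤ E i) {r : ℕ → ℝ} (hr : IsProbDist r) :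
    shEnt r ≤ meanE E r + ∑' i, ENNReal.ofReal (Real.exp (-1 * E i)) := by
  rw [shEnt, meanE, ← ENNReal.tsum_add]
  refine ENNReal.tsum_le_tsum fun i => ?_
  rw [← ENNReal.ofReal_add (mul_nonneg (hE i) (hr.1 i)) (Real.exp_pos _).le, neg_one_mul]
  exact ENNReal.ofReal_le_ofReal (negMulLog_le_mul_add_exp (hr.1 i) (E i))

lemma tsum_exp_ne_top {E : ℕ → ℝ} (hG : GibbsCond E) :
    ∑' i, ENNReal.ofReal (Real.exp (-1 * E i)) ≠ ⊤ :=
  (hG 1 one_pos).tsum_ofReal_ne_top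

lemma shEnt_ne_top {E : ℕ → ℝ} (hE : ∀ i, 0 ≤ E i) (hG : GibbsCond E) {r : ℕ → ℝ}
    (hr : IsProbDist r) (hm : meanE E r ≠ ⊤) : shEnt r ≠ ⊤ :=
  ne_top_of_le_ne_top (ENNReal.add_ne_top.mpr ⟨hm, tsum_exp_ne_top hG⟩) (shEnt_le hE hr)

lemma shEnt_toReal_le_FE {E : ℕ → ℝ} (hE : ∀ i, 0 ≤ E i) (hG : GibbsCond E) {r : ℕ → ℝ}
    (hr : IsProbDist r) {t : ℝ} (hm : meanE E r ≤ ENNReal.ofReal t) :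
    (shEnt r).toReal ≤ FE E t := by
  refine le_csSup ⟨(ENNReal.ofReal t + ∑' i, ENNReal.ofReal (Real.exp (-1 * E i))).toReal, ?_⟩
    ⟨r, hr, hm, rfl⟩
  rintro _ ⟨s, hs, hst, rfl⟩
  refine ENNReal.toReal_mono (ENNReal.add_ne_top.mpr ⟨ENNReal.ofReal_ne_top, tsum_exp_ne_top hG⟩)
    ((shEnt_le hE hs).trans ?_)
  gcongr

lemma FE_nonneg (E : ℕ → ℝ) (t : ℝ) : 0 ≤ FE E t := by
  refine Real.sSup_nonneg ?_
  rintro _ ⟨s, -, -, rfl⟩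
  exact ENNReal.toReal_nonneg

/-- Mixing with the ground state rescales the energy and loses at most the same factor of the
entropy. -/
lemma mul_shEnt_toReal_le_FE {E : ℕ → ℝ} (hE0 : E 0 = 0) (hE : ∀ i, 0 ≤ E i)
    (hG : GibbsCond E) {r : ℕ → ℝ} (hr : IsProbDist r) {s t : ℝ} (hs0 : 0 ≤ s) (hs1 : s ≤ 1)
    (hm : meanE E r ≤ ENNReal.ofReal t) :
    s * (shEnt r).toReal ≤ FE E (s * t) := by
  set r' : ℕ → ℝ := fun i => s * r i + (1 - s) * (if i = 0 then 1 else 0) with hr'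
  have hprob : IsProbDist r' := by
    refine ⟨fun i => ?_, ?_⟩
    · have := hr.1 i
      have : 0 ≤ 1 - s := by linarith
      simp only [hr']
      positivity
    · have h := (hr.2.mul_left s).add ((hasSum_ite_eq (0 : ℕ) (1 : ℝ)).mul_left (1 - s))
      rwa [mul_one, mul_one, add_sub_cancel] at h
  have hmean : meanE E r' ≤ ENNReal.ofReal (s * t) := by
    calc meanE E r' = ∑' i, ENNReal.ofReal s * ENNReal.ofReal (E i * r i) := by
          refine tsum_congr fun i => ?_
          rw [← ENNReal.ofReal_mul hs0]
          congr 1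
          rcases eq_or_ne i 0 with rfl | hi
          · simp [hE0]
          · simp only [hr', if_neg hi]
            ring
      _ = ENNReal.ofReal s * meanE E r := ENNReal.tsum_mul_left
      _ ≤ ENNReal.ofReal s * ENNReal.ofReal t := by gcongr
      _ = ENNReal.ofReal (s * t) := (ENNReal.ofReal_mul hs0).symm
  have hent : ENNReal.ofReal s * shEnt r ≤ shEnt r' := by
    rw [shEnt, ← ENNReal.tsum_mul_left]
    refine ENNReal.tsum_le_tsum fun i => ?_
    rw [← ENNReal.ofReal_mul hs0]
    refine ENNReal.ofReal_le_ofReal ?_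
    have h0 : Real.negMulLog (if i = 0 then 1 else 0) = 0 := by split_ifs <;> simp
    have h := Real.concaveOn_negMulLog.2 (x := r i) (y := if i = 0 then 1 else 0) (hr.1 i)
      (by rw [Set.mem_Ici]; split_ifs <;> norm_num) hs0 (sub_nonneg.mpr hs1) (by ring)
    simpa [h0, hr'] using h
  have hfin := shEnt_ne_top hE hG hprob (ne_top_of_le_ne_top ENNReal.ofReal_ne_top hmean)
  have := ENNReal.toReal_mono hfin hent
  rw [ENNReal.toReal_mul, ENNReal.toReal_ofReal hs0] at this
  exact this.trans (shEnt_toReal_le_FE hE hG hprob hmean)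

lemma margEntSum_one {n : ℕ} (hn : 1 ≤ n) (p : (Fin n → ℕ) → ℝ) :
    margEntSum 1 p = shEnt (margN p ⟨0, hn⟩) := by
  have : Finset.univ.filter (fun k : Fin n => (k : ℕ) < 1) = {⟨0, hn⟩} := by
    ext k
    simp [Fin.ext_iff]
  rw [margEntSum, this, Finset.sum_singleton]

lemma sub_le_of_inClassT {n : ℕ} (hn : 1 ≤ n)
    {E : ℕ → ℝ} (hE0 : E 0 = 0) (hEnn : ∀ i, 0 ≤ E i) (hGibbs : GibbsCond E)
    {P₀ : Set ((Fin n → ℕ) → ℝ)} (hprob : ∀ p ∈ P₀, IsProbDist p) (hdelta : DeltaProp P₀)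
    {C D : ℝ} (hD : 0 ≤ D) {f : ((Fin n → ℕ) → ℝ) → ℝ} (hf : InClassT 1 C D P₀ f)
    {t ε : ℝ} {p q : (Fin n → ℕ) → ℝ} (hp : p ∈ P₀) (hq : q ∈ P₀) (hpq : p ≠ q)
    (hpt : meanE E (margN p ⟨0, hn⟩) ≤ ENNReal.ofReal t)
    (hqt : meanE E (margN q ⟨0, hn⟩) ≤ ENNReal.ofReal t)
    (hTV : TVd p q ≤ ε) :
    f p - f q ≤ C * ε * FE E (t / ε) + D * gFun ε := by
  obtain ⟨cm, cp, dm, dp, hcm, hcp, -, -, rfl, rfl, hmix, hbd⟩ := hf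
  obtain ⟨hpos, hneg⟩ := hdelta p hp q hq hpq
  have hδ := TVd_pos (hprob p hp) (hprob q hq) hpq
  set δ := TVd p q
  set a : (Fin n → ℕ) → ℝ := fun x => max (p x - q x) 0 / δ with ha
  set b : (Fin n → ℕ) → ℝ := fun x => max (q x - p x) 0 / δ with hb
  have hε : 0 < ε := hδ.trans_le hTV
  have entropy_le : ∀ r ∈ P₀, meanE E (margN r ⟨0, hn⟩) ≤ ENNReal.ofReal (t / δ) →
      margEntSum 1 r ≠ ⊤ ∧ δ * (margEntSum 1 r).toReal ≤ ε * FE E (t / ε) := by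
    intro r hr hm
    have hrp := isProbDist_margN (hprob r hr) ⟨0, hn⟩
    rw [margEntSum_one hn]
    refine ⟨shEnt_ne_top hEnn hGibbs hrp (ne_top_of_le_ne_top ENNReal.ofReal_ne_top hm), ?_⟩
    have h := mul_shEnt_toReal_le_FE hE0 hEnn hGibbs hrp (s := δ / ε) (by positivity)
      ((div_le_one hε).mpr hTV) hm
    rw [show δ / ε * (t / δ) = t / ε by field_simp, div_mul_eq_mul_div, div_le_iff₀ hε] at h
    linarith
  obtain ⟨haf, ha_ent⟩ := entropy_le a hpos <|
    meanE_margN_le_div hEnn (hprob p hp) (hprob a hpos) hδ (fun x => by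
      rw [ha, mul_div_cancel₀ _ hδ.ne']
      exact max_le (by linarith [(hprob q hq).1 x]) ((hprob p hp).1 x)) _ hpt
  obtain ⟨hbf, hb_ent⟩ := entropy_le b hneg <|
    meanE_margN_le_div hEnn (hprob q hq) (hprob b hneg) hδ (fun x => by
      rw [hb, mul_div_cancel₀ _ hδ.ne']
      exact max_le (by linarith [(hprob p hp).1 x]) ((hprob q hq).1 x)) _ hqt
  have hl0 : 0 ≤ 1 / (1 + δ) := by positivity
  have hl1 : 1 / (1 + δ) ≤ 1 := (div_le_one (by positivity)).mpr (by linarith)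
  have heq : (fun x => 1 / (1 + δ) * p x + (1 - 1 / (1 + δ)) * b x) =
      fun x => 1 / (1 + δ) * q x + (1 - 1 / (1 + δ)) * a x := by
    ext x
    have hx : p x + max (q x - p x) 0 = q x + max (p x - q x) 0 := by
      rcases le_total (p x) (q x) with h | h
      · rw [max_eq_left (by linarith), max_eq_right (by linarith)]
        ring
      · rw [max_eq_right (by linarith), max_eq_left (by linarith)]
        ring
    simp only [ha, hb]
    field_simp
    linear_combination δ * hx
  have h1 := (hmix p hp b hneg _ hl0 hl1).1
  have h2' := (hmix q hq a hpos _ hl0 hl1).2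
  rw [heq] at h1
  have h3 := mul_le_mul_of_nonneg_left (h1.trans h2') (by positivity : 0 ≤ 1 + δ)
  have hg := one_add_mul_h2_inv hδ
  have hone : (1 + δ) * (1 / (1 + δ)) = 1 := by field_simp
  have h4 : f p - f q ≤ δ * f a - δ * f b + (dm + dp) * gFun δ := by
    rw [← hg]
    linear_combination h3 + (f q - f a - f p + f b) * hone
  have h5 := mul_le_mul_of_nonneg_left (hbd a hpos haf).2 hδ.le
  have h6 := mul_le_mul_of_nonneg_left (hbd b hneg hbf).1 hδ.le
  have h7 := mul_le_mul_of_nonneg_left ha_ent hcp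
  have h8 := mul_le_mul_of_nonneg_left hb_ent hcm
  have h9 := mul_le_mul_of_nonneg_left (gFun_monotoneOn hδ.le hε.le hTV) hD
  linarith

/-- **Two-sided continuity bound under an energy-type constraint** for functions
of the class `T_n^1(C,D)` on a convex set `P₀` with the Δ-property:
if the first marginals of `p, q ∈ P₀` have mean energy at most `t` and
`TV(p,q) ≤ ε`, then `|f(p) − f(q)| ≤ C·ε·F_E(t/ε) + D·g(ε)`. -/
theorem classT_energy_two_side_bound {n : ℕ} (hn : 1 ≤ n)
    (E : ℕ → ℝ) (hmono : Monotone E) (hE0 : E 0 = 0) (hEnn : ∀ i, 0 ≤ E i)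
    (hGibbs : GibbsCond E)
    (P₀ : Set ((Fin n → ℕ) → ℝ)) (hprob : ∀ p ∈ P₀, IsProbDist p)
    (hconv : ConvexDist P₀) (hdelta : DeltaProp P₀)
    (C D : ℝ) (hC : 0 ≤ C) (hD : 0 ≤ D)
    (f : ((Fin n → ℕ) → ℝ) → ℝ) (hf : InClassT 1 C D P₀ f)
    (t : ℝ) (ht : 0 < t) (ε : ℝ) (hε0 : 0 < ε) (hε1 : ε ≤ 1)
    (p q : (Fin n → ℕ) → ℝ) (hp : p ∈ P₀) (hq : q ∈ P₀)
    (hpt : meanE E (margN p ⟨0, hn⟩) ≤ ENNReal.ofReal t)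
    (hqt : meanE E (margN q ⟨0, hn⟩) ≤ ENNReal.ofReal t)
    (hTV : TVd p q ≤ ε) :
    |f p - f q| ≤ C * ε * FE E (t / ε) + D * gFun ε := by
  rcases eq_or_ne p q with rfl | hpq
  · rw [sub_self, abs_zero]
    have := FE_nonneg E (t / ε)
    have := gFun_nonneg hε0.le
    positivity
  · refine abs_sub_le_iff.mpr ⟨?_, ?_⟩
    · exact sub_le_of_inClassT hn hE0 hEnn hGibbs hprob hdelta hD hf hp hq hpq hpt hqt hTV
    · exact sub_le_of_inClassT hn hE0 hEnn hGibbs hprob hdelta hD hf hq hp hpq.symm hqt hpt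
        (TVd_comm q p ▸ hTV)
end

section
/- For every t > 0, the supremum of the Shannon entropy H(p) over all probability distributions p on ℕ with mean ∑_i i·(p i) ≤ t equals g(t) = (t+1)·ln(t+1) − t·ln t, and it is attained by the geometric distribution p i = tⁱ/(t+1)^{i+1}. -/
open scoped ENNReal

/-- Pointwise Gibbs inequality. -/
theorem negMulLog_le_neg_mul_log_add_sub {x y : ℝ} (hx : 0 ≤ x) (hy : 0 < y) :
    Real.negMulLog x ≤ -x * Real.log y + (y - x) := by
  rcases hx.eq_or_lt with rfl | hx
  · simpa using hy.le
  · have h := mul_le_mul_of_nonneg_left (Real.log_le_sub_one_of_pos (div_pos hy hx)) hx.le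
    rw [Real.log_div hy.ne' hx.ne', mul_sub, mul_sub, mul_div_cancel₀ _ hx.ne'] at h
    unfold Real.negMulLog
    linarith

theorem gFun_eq_log_add_mul (t : ℝ) :
    gFun t = Real.log (t + 1) + (Real.log (t + 1) - Real.log t) * t := by
  unfold gFun
  ring

theorem log_add_one_sub_log_nonneg {t : ℝ} (ht : 0 < t) :
    0 ≤ Real.log (t + 1) - Real.log t :=
  sub_nonneg.2 (Real.log_le_log ht (by linarith))

theorem gFun_nonneg_s9 {t : ℝ} (ht : 0 < t) : 0 ≤ gFun t := by
  rw [gFun_eq_log_add_mul]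
  have := Real.log_nonneg (show (1 : ℝ) ≤ t + 1 by linarith)
  have := mul_nonneg (log_add_one_sub_log_nonneg ht) ht.le
  linarith

theorem IsProbDist.le_one {α : Type*} {p : α → ℝ} (hp : IsProbDist p) (i : α) : p i ≤ 1 :=
  le_hasSum hp.2 i fun j _ => hp.1 j

theorem neg_log_geometric {t : ℝ} (ht : 0 < t) (i : ℕ) :
    -Real.log (t ^ i / (t + 1) ^ (i + 1)) =
      Real.log (t + 1) + (Real.log (t + 1) - Real.log t) * i := by
  rw [Real.log_div (by positivity) (by positivity), Real.log_pow, Real.log_pow]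
  push_cast
  ring

theorem geometric_eq_mul_pow (t : ℝ) (i : ℕ) :
    t ^ i / (t + 1) ^ (i + 1) = (t + 1)⁻¹ * (t / (t + 1)) ^ i := by
  rw [div_pow, pow_succ, div_eq_mul_inv, div_eq_mul_inv, mul_inv]
  ring

theorem isProbDist_geometric {t : ℝ} (ht : 0 < t) :
    IsProbDist (fun i : ℕ => t ^ i / (t + 1) ^ (i + 1)) := by
  refine ⟨fun i => by positivity, ?_⟩
  have hr : t / (t + 1) < 1 := (div_lt_one (by linarith)).2 (by linarith)
  have h := (hasSum_geometric_of_lt_one (by positivity) hr).mul_left (t + 1)⁻¹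
  simp only [geometric_eq_mul_pow]
  have hval : (t + 1)⁻¹ * (1 - t / (t + 1))⁻¹ = 1 := by
    rw [one_sub_div (by positivity), add_sub_cancel_left]
    field_simp
  rwa [hval] at h

theorem hasSum_coe_mul_geometric {t : ℝ} (ht : 0 < t) :
    HasSum (fun i : ℕ => (i : ℝ) * (t ^ i / (t + 1) ^ (i + 1))) t := by
  have hr : ‖t / (t + 1)‖ < 1 := by
    rw [Real.norm_of_nonneg (by positivity)]
    exact (div_lt_one (by linarith)).2 (by linarith)
  have h := (hasSum_coe_mul_geometric_of_norm_lt_one hr).mul_left (t + 1)⁻¹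
  have hval : (t + 1)⁻¹ * (t / (t + 1) / (1 - t / (t + 1)) ^ 2) = t := by
    rw [one_sub_div (by positivity), add_sub_cancel_left]
    field_simp
  rw [hval] at h
  refine h.congr_fun fun i => ?_
  rw [geometric_eq_mul_pow]
  ring

theorem meanE_geometric {t : ℝ} (ht : 0 < t) :
    meanE (fun i => (i : ℝ)) (fun i : ℕ => t ^ i / (t + 1) ^ (i + 1)) = ENNReal.ofReal t := by
  have h := hasSum_coe_mul_geometric ht
  rw [meanE, ← ENNReal.ofReal_tsum_of_nonneg (fun i => by positivity) h.summable, h.tsum_eq]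

theorem shEnt_geometric {t : ℝ} (ht : 0 < t) :
    shEnt (fun i : ℕ => t ^ i / (t + 1) ^ (i + 1)) = ENNReal.ofReal (gFun t) := by
  have hq := isProbDist_geometric ht
  have h : HasSum (fun i : ℕ => Real.negMulLog (t ^ i / (t + 1) ^ (i + 1))) (gFun t) := by
    have h := (hq.2.mul_left (Real.log (t + 1))).add
      ((hasSum_coe_mul_geometric ht).mul_left (Real.log (t + 1) - Real.log t))
    rw [mul_one, ← gFun_eq_log_add_mul] at h
    refine h.congr_fun fun i => ?_
    rw [Real.negMulLog, neg_mul_comm, neg_log_geometric ht]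
    ring
  rw [shEnt, ← ENNReal.ofReal_tsum_of_nonneg
    (fun i => Real.negMulLog_nonneg (hq.1 i) (hq.le_one i)) h.summable, h.tsum_eq]

theorem shEnt_le_of_meanE_le {t : ℝ} (ht : 0 < t) {p : ℕ → ℝ} (hp : IsProbDist p)
    (hm : meanE (fun i => (i : ℝ)) p ≤ ENNReal.ofReal t) :
    shEnt p ≤ ENNReal.ofReal (gFun t) := by
  have hnonneg (i : ℕ) : 0 ≤ (i : ℝ) * p i := mul_nonneg i.cast_nonneg (hp.1 i)
  have hsum : Summable fun i : ℕ => (i : ℝ) * p i := by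
    have h := ENNReal.summable_toReal (ne_top_of_le_ne_top ENNReal.ofReal_ne_top hm)
    simpa only [ENNReal.toReal_ofReal (hnonneg _)] using h
  have hle : ∑' i : ℕ, (i : ℝ) * p i ≤ t := by
    rwa [meanE, ← ENNReal.ofReal_tsum_of_nonneg hnonneg hsum,
      ENNReal.ofReal_le_ofReal_iff ht.le] at hm
  have hbound := ((hp.2.mul_left (Real.log (t + 1))).add
    (hsum.hasSum.mul_left (Real.log (t + 1) - Real.log t))).add
      ((isProbDist_geometric ht).2.sub hp.2)
  have hpt (i : ℕ) : Real.negMulLog (p i) ≤ Real.log (t + 1) * p i +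
      (Real.log (t + 1) - Real.log t) * (i * p i) +
        (t ^ i / (t + 1) ^ (i + 1) - p i) := by
    have h := negMulLog_le_neg_mul_log_add_sub (hp.1 i)
      (show 0 < t ^ i / (t + 1) ^ (i + 1) by positivity)
    rw [neg_mul_comm, neg_log_geometric ht] at h
    linarith
  calc shEnt p ≤ ∑' i : ℕ, ENNReal.ofReal (Real.log (t + 1) * p i +
        (Real.log (t + 1) - Real.log t) * (i * p i) +
          (t ^ i / (t + 1) ^ (i + 1) - p i)) :=
        ENNReal.tsum_le_tsum fun i => ENNReal.ofReal_le_ofReal (hpt i)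
    _ = ENNReal.ofReal (Real.log (t + 1) * 1 +
        (Real.log (t + 1) - Real.log t) * (∑' i : ℕ, (i : ℝ) * p i) + (1 - 1)) := by
        rw [← ENNReal.ofReal_tsum_of_nonneg
          (fun i => (Real.negMulLog_nonneg (hp.1 i) (hp.le_one i)).trans (hpt i))
          hbound.summable, hbound.tsum_eq]
    _ ≤ ENNReal.ofReal (gFun t) := by
        refine ENNReal.ofReal_le_ofReal ?_
        have := mul_le_mul_of_nonneg_left hle (log_add_one_sub_log_nonneg ht)
        rw [gFun_eq_log_add_mul]
        linarith

/-- **Maximal entropy under a mean constraint**: for `t > 0`, the supremum of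
`H(p)` over probability distributions on `ℕ` with mean `∑ i·p i ≤ t` equals
`g(t) = (t+1)·ln(t+1) − t·ln t`, and it is attained by the geometric
distribution `p i = tⁱ/(t+1)^{i+1}`. -/
theorem entropy_sup_mean_constraint_eq_g (t : ℝ) (ht : 0 < t) :
    IsGreatest {h : EReal | ∃ p : ℕ → ℝ, IsProbDist p ∧
        meanE (fun i => (i : ℝ)) p ≤ ENNReal.ofReal t ∧ h = (shEnt p : EReal)}
      ((gFun t : ℝ) : EReal) ∧
    IsProbDist (fun i : ℕ => t ^ i / (t + 1) ^ (i + 1)) ∧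
    meanE (fun i => (i : ℝ)) (fun i : ℕ => t ^ i / (t + 1) ^ (i + 1)) ≤
      ENNReal.ofReal t ∧
    shEnt (fun i : ℕ => t ^ i / (t + 1) ^ (i + 1)) = ENNReal.ofReal (gFun t) := by
  have hg : ((gFun t : ℝ) : EReal) = (ENNReal.ofReal (gFun t) : EReal) := by
    rw [EReal.coe_ennreal_ofReal, max_eq_left (gFun_nonneg_s9 ht)]
  refine ⟨⟨⟨_, isProbDist_geometric ht, (meanE_geometric ht).le, ?_⟩, ?_⟩,
    isProbDist_geometric ht, (meanE_geometric ht).le, shEnt_geometric ht⟩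
  · rw [hg, shEnt_geometric ht]
  · rintro _ ⟨p, hp, hm, rfl⟩
    rw [hg]
    exact EReal.coe_ennreal_le_coe_ennreal_iff.2 (shEnt_le_of_meanE_le ht hp hm)
end
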